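/- Let G be a finite simple connected graph on n vertices with adjacency matrix A and degrees d_i = ∑_j A_{ij} > 0, let α > 0 be such that for each vertex i the series ∑_{ℓ=0}^∞ α^ℓ (A^ℓ 𝟙)_i is summable, and define the Katz centrality r_i = ∑_{ℓ=0}^∞ α^ℓ (A^ℓ 𝟙)_i. If G is not regular (not all degrees d_i are equal), then the inequality is strict: ∑_i (1/d_i) ∑_j A_{ij} r_j > ∑_i r_i. -/

import Mathlib

open Finset in
theorem two_mul_sum_mul_div_sub_sum {ι : Type*} [Fintype ι] {B : Matrix ι ι ℝ}
    (hB : B.IsSymm) {d : ι → ℝ} (hd : ∀ i, 0 < d i) :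
    2 * (∑ i, (1 / d i) * ∑ j, B i j * d j - ∑ i, ∑ j, B i j) =
      ∑ i, ∑ j, B i j * ((d i - d j) ^ 2 / (d i * d j)) := by
  have hswap : ∑ i, (1 / d i) * ∑ j, B i j * d j = ∑ i, ∑ j, B i j * (d i / d j) := by
    simp_rw [mul_sum]
    rw [sum_comm]
    refine sum_congr rfl fun i _ => sum_congr rfl fun j _ => ?_
    rw [hB.apply i j]
    ring
  rw [two_mul, sub_add_sub_comm]
  nth_rw 1 [hswap]
  simp_rw [mul_sum, ← sum_add_distrib, ← sum_sub_distrib]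
  refine sum_congr rfl fun i _ => sum_congr rfl fun j _ => ?_
  have hi := (hd i).ne'
  have hj := (hd j).ne'
  field_simp
  ring

theorem sum_le_sum_mul_div {ι : Type*} [Fintype ι] {B : Matrix ι ι ℝ}
    (hB : B.IsSymm) (hB0 : ∀ i j, 0 ≤ B i j) {d : ι → ℝ} (hd : ∀ i, 0 < d i) :
    ∑ i, ∑ j, B i j ≤ ∑ i, (1 / d i) * ∑ j, B i j * d j := by
  have hnonneg : 0 ≤ ∑ i, ∑ j, B i j * ((d i - d j) ^ 2 / (d i * d j)) :=
    Finset.sum_nonneg fun i _ => Finset.sum_nonneg fun j _ =>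
      mul_nonneg (hB0 i j) (div_nonneg (sq_nonneg _) (mul_pos (hd i) (hd j)).le)
  linarith [two_mul_sum_mul_div_sub_sum hB hd]

theorem sum_lt_sum_mul_div {ι : Type*} [Fintype ι] {B : Matrix ι ι ℝ}
    (hB : B.IsSymm) (hB0 : ∀ i j, 0 ≤ B i j) {d : ι → ℝ} (hd : ∀ i, 0 < d i)
    {a b : ι} (hab : 0 < B a b) (hne : d a ≠ d b) :
    ∑ i, ∑ j, B i j < ∑ i, (1 / d i) * ∑ j, B i j * d j := by
  have hterm : ∀ i j, 0 ≤ B i j * ((d i - d j) ^ 2 / (d i * d j)) := fun i j =>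
    mul_nonneg (hB0 i j) (div_nonneg (sq_nonneg _) (mul_pos (hd i) (hd j)).le)
  have hpos : 0 < ∑ i, ∑ j, B i j * ((d i - d j) ^ 2 / (d i * d j)) :=
    Finset.sum_pos' (fun i _ => Finset.sum_nonneg fun j _ => hterm i j)
      ⟨a, Finset.mem_univ a, Finset.sum_pos' (fun j _ => hterm a j)
        ⟨b, Finset.mem_univ b, mul_pos hab
          (div_pos (sq_pos_of_ne_zero (sub_ne_zero.2 hne)) (mul_pos (hd a) (hd b)))⟩⟩
  linarith [two_mul_sum_mul_div_sub_sum hB hd]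

theorem Matrix.pow_apply_nonneg_of_nonneg {ι : Type*} [Fintype ι] [DecidableEq ι]
    {A : Matrix ι ι ℝ} (hA : ∀ i j, 0 ≤ A i j) (k : ℕ) (i j : ι) : 0 ≤ (A ^ k) i j := by
  induction k generalizing i j with
  | zero =>
    rw [pow_zero, Matrix.one_apply]
    split_ifs <;> norm_num
  | succ k ih =>
    rw [pow_succ, Matrix.mul_apply]
    exact Finset.sum_nonneg fun l _ => mul_nonneg (ih i l) (hA l j)

theorem SimpleGraph.Connected.exists_adj_apply_ne {V β : Type*} {G : SimpleGraph V}
    (hG : G.Connected) {f : V → β} (hf : ¬ ∀ i j, f i = f j) :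
    ∃ a b, G.Adj a b ∧ f a ≠ f b := by
  by_contra! h
  refine hf fun i j => ?_
  obtain ⟨p⟩ := hG.preconnected i j
  induction p with
  | nil => rfl
  | cons hadj _ ih => exact (h _ _ hadj).trans ih

/-- Strict centrality paradox for Katz centrality: under the same hypotheses, if the
graph is not regular (not all degrees are equal), then
`∑ᵢ (1/dᵢ) ∑ⱼ Aᵢⱼ rⱼ > ∑ᵢ rᵢ`. -/
theorem centrality_paradox_katz_strict {n : ℕ} (G : SimpleGraph (Fin n))
    [DecidableRel G.Adj] (hconn : G.Connected)
    (A : Matrix (Fin n) (Fin n) ℝ) (hA : A = G.adjMatrix ℝ)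
    (d : Fin n → ℝ) (hd : ∀ i, d i = ∑ j, A i j) (hdpos : ∀ i, 0 < d i)
    (α : ℝ) (hα : 0 < α)
    (hsum : ∀ i, Summable fun ℓ : ℕ => α ^ ℓ * (A ^ ℓ).mulVec 1 i)
    (r : Fin n → ℝ) (hr : ∀ i, r i = ∑' ℓ : ℕ, α ^ ℓ * (A ^ ℓ).mulVec 1 i)
    (hnonreg : ¬ ∀ i j, d i = d j) :
    ∑ i, (1 / d i) * ∑ j, A i j * r j > ∑ i, r i := by
  have hsymm : A.IsSymm := hA ▸ G.isSymm_adjMatrix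
  have hnonneg : ∀ i j, 0 ≤ A i j := fun i j => by
    rw [hA, SimpleGraph.adjMatrix_apply]
    split_ifs <;> norm_num
  obtain ⟨a, b, hadj, hne⟩ := hconn.exists_adj_apply_ne hnonreg
  have hab : 0 < A a b := by simp [hA, hadj]
  have hrs : ∀ i, HasSum (fun ℓ : ℕ => α ^ ℓ * (A ^ ℓ).mulVec 1 i) (r i) := fun i =>
    hr i ▸ (hsum i).hasSum
  have hleft : HasSum (fun ℓ : ℕ => ∑ i, α ^ ℓ * (A ^ ℓ).mulVec 1 i) (∑ i, r i) :=
    hasSum_sum fun i _ => hrs i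
  have hright : HasSum
      (fun ℓ : ℕ => ∑ i, (1 / d i) * ∑ j, A i j * (α ^ ℓ * (A ^ ℓ).mulVec 1 j))
      (∑ i, (1 / d i) * ∑ j, A i j * r j) :=
    hasSum_sum fun i _ => (hasSum_sum fun j _ => (hrs j).mul_left _).mul_left _
  have hd' : d = A.mulVec 1 := by
    ext i
    simp [hd, Matrix.mulVec, dotProduct]
  have hl : ∀ ℓ : ℕ, ∑ i, α ^ ℓ * (A ^ ℓ).mulVec 1 i = α ^ ℓ * ∑ i, ∑ j, (A ^ ℓ) i j :=
    fun ℓ => by simp [Matrix.mulVec, dotProduct, Finset.mul_sum]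
  have hstep : ∀ (ℓ : ℕ) (i : Fin n),
      ∑ j, A i j * (A ^ ℓ).mulVec 1 j = ∑ j, (A ^ ℓ) i j * d j := fun ℓ i => by
    change A.mulVec ((A ^ ℓ).mulVec 1) i = (A ^ ℓ).mulVec d i
    rw [hd', Matrix.mulVec_mulVec, Matrix.mulVec_mulVec, ← pow_succ, ← pow_succ']
  have hrt : ∀ ℓ : ℕ, ∑ i, (1 / d i) * ∑ j, A i j * (α ^ ℓ * (A ^ ℓ).mulVec 1 j) =
      α ^ ℓ * ∑ i, (1 / d i) * ∑ j, (A ^ ℓ) i j * d j := fun ℓ => by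
    simp_rw [← hstep, mul_left_comm _ (α ^ ℓ), ← Finset.mul_sum, mul_left_comm _ (α ^ ℓ),
      ← Finset.mul_sum]
  simp_rw [hl] at hleft
  simp_rw [hrt] at hright
  refine hasSum_lt (i := 1) (fun ℓ => ?_) ?_ hleft hright
  · exact mul_le_mul_of_nonneg_left (sum_le_sum_mul_div (hsymm.pow ℓ)
      (Matrix.pow_apply_nonneg_of_nonneg hnonneg ℓ) hdpos) (by positivity)
  · simp only [pow_one]
    exact mul_lt_mul_of_pos_left (sum_lt_sum_mul_div hsymm hnonneg hdpos hab hne) hα
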